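/- arXiv:2201.03087 — 2 statements merged into one kernel-verified Lean document; each statement's English description precedes it below -/
import Mathlib

section
/- For each $k$-element subset $I \subseteq \{1,\dots,n\}$, the orthogonal projection $v_I = \pi(V_I)$ is given explicitly by $v_I = V_I + \sum_{\ell=0}^{k-1} b_\ell \sum_{K} f\,V_K$, where the inner sum is over all $(k-1)$-element subsets $K \subseteq \{1,\dots,n\}$ with $|I \cap K| = \ell$, and $b_\ell = (-1)^{k-\ell}\,(k-\ell-1)!\,(n-2k+\ell+1)!/(n-k+1)!$ for $\ell = 0,\dots,k-1$. -/
noncomputable section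

/-- The `sl₂`-module `W^{⊗n}`, `W = ℂ²`, identified with the free complex vector space
on the set of subsets of `{1,…,n}`. -/
abbrev WT (n : ℕ) := Finset (Fin n) →₀ ℂ

/-- Build a linear operator on `WT n` from its values on the basis vectors `V_I`. -/
def mkOp {n : ℕ} (φ : Finset (Fin n) → WT n) : WT n →ₗ[ℂ] WT n :=
  Finsupp.lsum ℂ fun I => LinearMap.toSpanSingleton ℂ (WT n) (φ I)

/-- Diagonal action of `e`: `e V_I = ∑_{i ∈ I} V_{I∖{i}}`. -/
def opE (n : ℕ) : WT n →ₗ[ℂ] WT n :=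
  mkOp fun I => ∑ i ∈ I, Finsupp.single (I.erase i) 1

/-- Diagonal action of `f`: `f V_I = ∑_{i ∉ I} V_{I∪{i}}`. -/
def opF (n : ℕ) : WT n →ₗ[ℂ] WT n :=
  mkOp fun I => ∑ i ∈ Iᶜ, Finsupp.single (insert i I) 1

/-- Diagonal action of `h`: `h V_I = (n - 2|I|) V_I`. -/
def opH (n : ℕ) : WT n →ₗ[ℂ] WT n :=
  mkOp fun I => ((n : ℂ) - 2 * I.card) • Finsupp.single I 1

/-- The Shapovalov form: the symmetric bilinear form with `(V_I, V_J) = δ_{IJ}`. -/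
def shap {n : ℕ} (x y : WT n) : ℂ := x.sum fun I c => c * y I

/-- The weight space `W^{⊗n}[n-2k]`, spanned by the `V_I` with `|I| = k`. -/
def weight (n k : ℕ) : Submodule ℂ (WT n) :=
  Submodule.span ℂ {x | ∃ I : Finset (Fin n), I.card = k ∧ x = Finsupp.single I 1}

/-- The space of singular vectors `Sing W^{⊗n}[n-2k] = {w ∈ W^{⊗n}[n-2k] : e w = 0}`. -/
def sing (n k : ℕ) : Submodule ℂ (WT n) :=
  weight n k ⊓ LinearMap.ker (opE n)

/-- `b_ℓ = (-1)^{k-ℓ} (k-ℓ-1)! (n-2k+ℓ+1)! / (n-k+1)!`. -/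
def bCoef (n k ℓ : ℕ) : ℂ :=
  (-1) ^ (k - ℓ) * ((k - ℓ - 1).factorial : ℂ) * ((n - 2 * k + ℓ + 1).factorial : ℂ) /
    ((n - k + 1).factorial : ℂ)

/-- `a_ℓ = (-1)^{k+ℓ} (n-2k+1) (k-ℓ)! (n-2k+ℓ)! / (n-k+1)!`. -/
def aCoef (n k ℓ : ℕ) : ℂ :=
  (-1) ^ (k + ℓ) * ((n - 2 * k + 1 : ℕ) : ℂ) * ((k - ℓ).factorial : ℂ) *
    ((n - 2 * k + ℓ).factorial : ℂ) / ((n - k + 1).factorial : ℂ)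

/-- The matrix coefficient form of `e`: `(e x)_L = ∑_{i ∉ L} x_{L ∪ {i}}`. -/
lemma opE_apply {n : ℕ} (x : WT n) (L : Finset (Fin n)) :
    opE n x L = ∑ i ∈ Lᶜ, x (insert i L) := by
  induction x using Finsupp.induction_linear with
  | zero => simp
  | add x y hx hy => simp [hx, hy, Finset.sum_add_distrib]
  | single J c =>
    simp only [opE, mkOp, Finsupp.lsum_single, LinearMap.toSpanSingleton_apply,
      Finsupp.smul_apply, Finsupp.finsetSum_apply, Finsupp.single_apply, smul_eq_mul,
      Finset.mul_sum, mul_ite, mul_one, mul_zero]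
    rw [← Finset.sum_filter, ← Finset.sum_filter]
    refine Finset.sum_congr ?_ fun _ _ => rfl
    ext i
    simp only [Finset.mem_filter, Finset.mem_compl]
    constructor
    · rintro ⟨hi, rfl⟩
      exact ⟨Finset.notMem_erase i J, (Finset.insert_erase hi).symm⟩
    · rintro ⟨hi, rfl⟩
      exact ⟨Finset.mem_insert_self i L, Finset.erase_insert hi⟩

/-- The matrix coefficient form of `f`: `(f x)_L = ∑_{i ∈ L} x_{L ∖ {i}}`. -/
lemma opF_apply {n : ℕ} (x : WT n) (L : Finset (Fin n)) :
    opF n x L = ∑ i ∈ L, x (L.erase i) := by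
  induction x using Finsupp.induction_linear with
  | zero => simp
  | add x y hx hy => simp [hx, hy, Finset.sum_add_distrib]
  | single J c =>
    simp only [opF, mkOp, Finsupp.lsum_single, LinearMap.toSpanSingleton_apply,
      Finsupp.smul_apply, Finsupp.finsetSum_apply, Finsupp.single_apply, smul_eq_mul,
      Finset.mul_sum, mul_ite, mul_one, mul_zero]
    rw [← Finset.sum_filter, ← Finset.sum_filter]
    refine Finset.sum_congr ?_ fun _ _ => rfl
    ext i
    simp only [Finset.mem_filter, Finset.mem_compl]
    constructor
    · rintro ⟨hi, rfl⟩
      exact ⟨Finset.mem_insert_self i J, (Finset.erase_insert hi).symm⟩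
    · rintro ⟨hi, rfl⟩
      exact ⟨Finset.notMem_erase i L, Finset.insert_erase hi⟩

lemma shap_eq_sum {n : ℕ} (x y : WT n) : shap x y = ∑ J, x J * y J :=
  Finsupp.sum_fintype _ _ (by simp)

lemma shap_add_left {n : ℕ} (x y z : WT n) : shap (x + y) z = shap x z + shap y z := by
  simp [shap_eq_sum, add_mul, Finset.sum_add_distrib]

lemma shap_single_left {n : ℕ} (J : Finset (Fin n)) (c : ℂ) (z : WT n) :
    shap (Finsupp.single J c) z = c * z J := by
  simp [shap]

lemma shap_comm {n : ℕ} (x y : WT n) : shap x y = shap y x := by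
  simp [shap_eq_sum, mul_comm]

/-- The operators `e` and `f` are adjoint for the Shapovalov form. -/
lemma shap_opF_left {n : ℕ} (x y : WT n) : shap (opF n x) y = shap x (opE n y) := by
  induction x using Finsupp.induction_linear with
  | zero => simp [shap]
  | add x z hx hz => rw [map_add, shap_add_left, shap_add_left, hx, hz]
  | single J c =>
    rw [shap_single_left, opE_apply, shap_eq_sum]
    simp only [opF, mkOp, Finsupp.lsum_single, LinearMap.toSpanSingleton_apply,
      Finsupp.smul_apply, Finsupp.finsetSum_apply, Finsupp.single_apply, smul_eq_mul,
      Finset.sum_mul, Finset.mul_sum, mul_ite, ite_mul, mul_one, mul_zero, zero_mul]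
    rw [Finset.sum_comm]
    simp

lemma mem_weight_iff {n k : ℕ} (x : WT n) :
    x ∈ weight n k ↔ ∀ J : Finset (Fin n), J.card ≠ k → x J = 0 := by
  have h : weight n k = Finsupp.supported ℂ ℂ {J : Finset (Fin n) | J.card = k} := by
    rw [Finsupp.supported_eq_span_single, weight]
    congr 1
    ext y
    simp [eq_comm]
  rw [h, Finsupp.mem_supported']
  rfl

lemma single_mem_weight {n k : ℕ} {I : Finset (Fin n)} (hI : I.card = k) :
    Finsupp.single I 1 ∈ weight n k :=
  Submodule.subset_span ⟨I, hI, rfl⟩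

/-- The three-term recurrence satisfied by the coefficients `b_ℓ`, with `k = a + c + 1` and
`n = 2k + r`. -/
lemma bCoef_recurrence {n k : ℕ} (a c r : ℕ) (hk : k = a + c + 1) (hn : n = 2 * k + r) :
    ((a + c + r + 2 : ℕ) : ℂ) * bCoef n k a +
      ((c + 1 : ℕ) * (a * bCoef n k a + c * bCoef n k (a + 1)) +
        (r + a + 1 : ℕ) * (a * bCoef n k (a - 1) + c * bCoef n k a)) =
      -(if c = 0 then 1 else 0) := by
  have hfac (m : ℕ) : (m.factorial : ℂ) ≠ 0 := Nat.cast_ne_zero.mpr m.factorial_ne_zero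
  have hup : (c : ℂ) * bCoef n k (a + 1) =
      -(if c = 0 then 0 else (r + a + 2 : ℂ) * bCoef n k a) := by
    cases c with
    | zero => simp
    | succ c =>
      have e1 : k - (a + 1) = c + 1 := by omega
      have e2 : k - a = c + 2 := by omega
      have e3 : n - 2 * k = r := by omega
      simp only [bCoef, e1, e2, e3, show c + 1 - 1 = c by omega,
        show c + 2 - 1 = c + 1 by omega, ← add_assoc, Nat.factorial_succ (r + a + 1),
        Nat.factorial_succ c]
      push_cast
      field_simp
      ring
  have hdown : ((r + a + 1 : ℕ) : ℂ) * (a * bCoef n k (a - 1)) =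
      -((a : ℂ) * (c + 1) * bCoef n k a) := by
    cases a with
    | zero => simp
    | succ a =>
      have e1 : k - (a + 1) = c + 1 := by omega
      have e2 : k - a = c + 2 := by omega
      have e3 : n - 2 * k = r := by omega
      simp only [bCoef, e1, e2, e3, Nat.add_sub_cancel, show c + 2 - 1 = c + 1 by omega,
        ← add_assoc, Nat.factorial_succ (r + a + 1), Nat.factorial_succ c]
      push_cast
      field_simp
      ring
  rcases eq_or_ne c 0 with rfl | hc
  · have hlast : ((a + r + 2 : ℕ) : ℂ) * bCoef n k a = -1 := by
      have e2 : k - a = 1 := by omega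
      have e3 : n - 2 * k = r := by omega
      have e4 : n - k + 1 = r + a + 1 + 1 := by omega
      rw [bCoef, e2, e3, e4, Nat.factorial_succ (r + a + 1)]
      have h1 : (r + a + 1 + 1 : ℂ) ≠ 0 := by exact_mod_cast Nat.succ_ne_zero (r + a + 1)
      have h2 := hfac (r + a + 1)
      push_cast
      simp
      field_simp
      ring
    push_cast at hlast hdown ⊢
    linear_combination hlast + hdown
  · rw [if_neg hc] at hup ⊢
    push_cast at hdown ⊢
    linear_combination (c + 1 : ℂ) * hup + hdown

/-- The vector `∑_ℓ b_ℓ ∑_K V_K`, with `|K| = k - 1` and `|I ∩ K| = ℓ`, to which `f` is applied in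
the formula for the projection of `V_I`. -/
def preCorrection (n k : ℕ) (I : Finset (Fin n)) : WT n :=
  ∑ ℓ ∈ Finset.range k, bCoef n k ℓ •
    ∑ K ∈ Finset.univ.filter
        (fun K : Finset (Fin n) => K.card = k - 1 ∧ (I ∩ K).card = ℓ),
      Finsupp.single K 1

lemma preCorrection_apply {n k : ℕ} (hk : 1 ≤ k) (I K : Finset (Fin n)) :
    preCorrection n k I K = if K.card = k - 1 then bCoef n k (I ∩ K).card else 0 := by
  simp only [preCorrection, Finsupp.finsetSum_apply, Finsupp.smul_apply, Finsupp.single_apply,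
    smul_eq_mul, Finset.sum_ite_eq', Finset.mem_filter, Finset.mem_univ, true_and, mul_ite,
    mul_one, mul_zero]
  split_ifs with h
  · have : (I ∩ K).card < k := by
      have := Finset.card_le_card (Finset.inter_subset_right (s₁ := I) (s₂ := K))
      omega
    simp [h, this]
  · simp [h]

lemma single_add_opF_mem_weight {n k : ℕ} (hk : 1 ≤ k) {I : Finset (Fin n)} (hI : I.card = k) :
    Finsupp.single I 1 + opF n (preCorrection n k I) ∈ weight n k := by
  refine add_mem (single_mem_weight hI) ((mem_weight_iff _).mpr fun J hJ => ?_)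
  rw [opF_apply]
  refine Finset.sum_eq_zero fun i hi => ?_
  rw [preCorrection_apply hk, if_neg]
  rw [Finset.card_erase_of_mem hi]
  have := Finset.card_pos.mpr ⟨i, hi⟩
  omega

lemma card_inter_erase_insert {n : ℕ} (I L : Finset (Fin n)) {i j : Fin n}
    (hi : i ∉ L) (hj : j ∈ L) :
    (I ∩ (insert i L).erase j).card =
      if i ∈ I then (if j ∈ I then (I ∩ L).card else (I ∩ L).card + 1)
      else (if j ∈ I then (I ∩ L).card - 1 else (I ∩ L).card) := by
  have hij : i ≠ j := fun h => hi (h ▸ hj)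
  rw [Finset.inter_erase]
  by_cases hiI : i ∈ I <;> by_cases hjI : j ∈ I <;>
    simp [Finset.inter_insert_of_mem, Finset.inter_insert_of_notMem, Finset.card_erase_of_mem,
      Finset.erase_eq_of_notMem, hiI, hjI, hi, hj, hij.symm]

/-- The coefficient of `e f (∑_ℓ b_ℓ ∑_K V_K)` at a `(k-1)`-element subset. -/
lemma opE_opF_preCorrection_apply {n k : ℕ} (hk : 1 ≤ k) (hn : 2 * k ≤ n)
    {I L : Finset (Fin n)} (hI : I.card = k) (hL : L.card = k - 1) :
    opE n (opF n (preCorrection n k I)) L = -(if L ⊆ I then 1 else 0) := by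
  have hLle : (I ∩ L).card ≤ L.card := Finset.card_le_card Finset.inter_subset_right
  obtain ⟨a, ha⟩ : ∃ a, (I ∩ L).card = a := ⟨_, rfl⟩
  obtain ⟨c, hc⟩ : ∃ c, k = a + c + 1 := ⟨k - 1 - a, by omega⟩
  obtain ⟨r, hr⟩ : ∃ r, n = 2 * k + r := ⟨n - 2 * k, by omega⟩
  have hsub : L ⊆ I ↔ c = 0 := by
    rw [← Finset.inter_eq_right]
    constructor
    · intro h
      rw [h] at ha
      omega
    · intro h
      exact Finset.eq_of_subset_of_card_le Finset.inter_subset_right (by omega)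
  have hLI : (L.filter (· ∈ I)).card = a := by
    rw [Finset.filter_mem_eq_inter, Finset.inter_comm, ha]
  have hLnI : (L.filter (· ∉ I)).card = c := by
    have := Finset.card_filter_add_card_filter_not (s := L) (· ∈ I)
    omega
  have hCI : (Lᶜ.filter (· ∈ I)).card = c + 1 := by
    have h1 := Finset.card_inter_add_card_sdiff I L
    have h2 : Lᶜ.filter (· ∈ I) = I \ L := by
      ext; simp [and_comm]
    rw [h2]
    omega
  have hC : Lᶜ.card = a + c + r + 2 := by
    rw [Finset.card_compl, Fintype.card_fin]
    omega
  have hCnI : (Lᶜ.filter (· ∉ I)).card = r + a + 1 := by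
    have := Finset.card_filter_add_card_filter_not (s := Lᶜ) (· ∈ I)
    omega
  have hterm : ∀ i ∈ Lᶜ, opF n (preCorrection n k I) (insert i L) =
      bCoef n k a + if i ∈ I then a * bCoef n k a + c * bCoef n k (a + 1)
        else a * bCoef n k (a - 1) + c * bCoef n k a := by
    intro i hi
    rw [Finset.mem_compl] at hi
    rw [opF_apply, Finset.sum_insert hi, Finset.erase_insert hi, preCorrection_apply hk,
      if_pos hL, ha]
    congr 1
    have hj : ∀ j ∈ L, preCorrection n k I ((insert i L).erase j) =
        if j ∈ I then (if i ∈ I then bCoef n k a else bCoef n k (a - 1))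
        else (if i ∈ I then bCoef n k (a + 1) else bCoef n k a) := by
      intro j hj
      rw [preCorrection_apply hk, if_pos, card_inter_erase_insert I L hi hj, ha]
      · split_ifs <;> rfl
      · rw [Finset.card_erase_of_mem (Finset.mem_insert_of_mem hj),
          Finset.card_insert_of_notMem hi]
        omega
    rw [Finset.sum_congr rfl hj, Finset.sum_ite, Finset.sum_const, Finset.sum_const, hLI, hLnI]
    split_ifs <;> simp
  rw [opE_apply, Finset.sum_congr rfl hterm, Finset.sum_add_distrib, Finset.sum_ite,
    Finset.sum_const, Finset.sum_const, Finset.sum_const, hC, hCI, hCnI]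
  simp only [nsmul_eq_mul, hsub]
  exact bCoef_recurrence a c r hc hr

lemma opE_single_apply {n k : ℕ} {I L : Finset (Fin n)} (hk : 1 ≤ k) (hI : I.card = k)
    (hL : L.card = k - 1) :
    opE n (Finsupp.single I 1) L = if L ⊆ I then 1 else 0 := by
  rw [opE_apply]
  simp only [Finsupp.single_apply]
  split_ifs with h
  · obtain ⟨i, hi⟩ : ∃ i, I \ L = {i} := by
      rw [← Finset.card_eq_one, Finset.card_sdiff_of_subset h]
      omega
    have hiI : i ∈ I \ L := hi ▸ Finset.mem_singleton_self i
    rw [Finset.mem_sdiff] at hiI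
    have hins : I = insert i L := by
      rw [Finset.insert_eq, ← hi, Finset.sdiff_union_of_subset h]
    rw [Finset.sum_eq_single i, if_pos hins]
    · intro j hj hji
      rw [if_neg]
      intro hIj
      have : j ∈ I \ L :=
        Finset.mem_sdiff.mpr ⟨hIj ▸ Finset.mem_insert_self j L, Finset.mem_compl.mp hj⟩
      rw [hi, Finset.mem_singleton] at this
      exact hji this
    · intro hi'
      exact absurd (Finset.mem_compl.mpr hiI.2) hi'
  · refine Finset.sum_eq_zero fun i _ => if_neg fun hIi => h ?_
    rw [hIi]
    exact Finset.subset_insert i L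

lemma single_add_opF_mem_sing {n k : ℕ} (hk : 1 ≤ k) (hn : 2 * k ≤ n)
    {I : Finset (Fin n)} (hI : I.card = k) :
    Finsupp.single I 1 + opF n (preCorrection n k I) ∈ sing n k := by
  have hw := single_add_opF_mem_weight hk hI
  refine ⟨hw, LinearMap.mem_ker.mpr ?_⟩
  ext L
  by_cases hL : L.card = k - 1
  · rw [map_add, Finsupp.add_apply, opE_single_apply hk hI hL,
      opE_opF_preCorrection_apply hk hn hI hL, add_neg_cancel, Finsupp.zero_apply]
  · rw [opE_apply, Finsupp.zero_apply]
    refine Finset.sum_eq_zero fun i hi => (mem_weight_iff _).mp hw _ ?_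
    rw [Finset.card_insert_of_notMem (Finset.mem_compl.mp hi)]
    omega

lemma shap_opF_of_mem_sing {n k : ℕ} (y : WT n) {s : WT n} (hs : s ∈ sing n k) :
    shap (opF n y) s = 0 := by
  rw [shap_opF_left, LinearMap.mem_ker.mp hs.2]
  simp [shap]

/-- The Shapovalov form is nondegenerate on the space of singular vectors. -/
lemma eq_zero_of_mem_sing_of_orthogonal {n k : ℕ} (hk : 1 ≤ k) (hn : 2 * k ≤ n) {d : WT n}
    (hd : d ∈ sing n k) (horth : ∀ s ∈ sing n k, shap d s = 0) : d = 0 := by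
  ext J
  by_cases hJ : J.card = k
  · have h := horth _ (single_add_opF_mem_sing hk hn hJ)
    rwa [shap_comm, shap_add_left, shap_opF_of_mem_sing _ hd, shap_single_left, one_mul,
      add_zero] at h
  · exact (mem_weight_iff d).mp hd.1 J hJ

/-- for a `k`-element subset `I`, the orthogonal projection
`v_I = π(V_I)` of `V_I` onto `Sing W^{⊗n}[n-2k]` (with respect to the Shapovalov form)
equals `V_I + ∑_{ℓ=0}^{k-1} b_ℓ ∑_{K : |K|=k-1, |I∩K|=ℓ} f V_K`. -/
theorem stmt0 (n k : ℕ) (hk : 1 ≤ k) (hn : 2 * k ≤ n)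
    (π : WT n →ₗ[ℂ] WT n)
    (hrange : ∀ x ∈ weight n k, π x ∈ sing n k)
    (hfix : ∀ x ∈ sing n k, π x = x)
    (horth : ∀ x ∈ weight n k, ∀ s ∈ sing n k, shap (x - π x) s = 0)
    (I : Finset (Fin n)) (hI : I.card = k) :
    π (Finsupp.single I 1) =
      Finsupp.single I 1 +
        ∑ ℓ ∈ Finset.range k, bCoef n k ℓ •
          ∑ K ∈ Finset.univ.filter
              (fun K : Finset (Fin n) => K.card = k - 1 ∧ (I ∩ K).card = ℓ),
            opF n (Finsupp.single K 1) := by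
  have hsum : ∑ ℓ ∈ Finset.range k, bCoef n k ℓ •
      ∑ K ∈ Finset.univ.filter
          (fun K : Finset (Fin n) => K.card = k - 1 ∧ (I ∩ K).card = ℓ),
        opF n (Finsupp.single K 1) = opF n (preCorrection n k I) := by
    simp only [preCorrection, map_sum, map_smul]
  rw [hsum, ← sub_eq_zero, ← neg_eq_zero, neg_sub]
  have hw : Finsupp.single I 1 ∈ weight n k := single_mem_weight hI
  refine eq_zero_of_mem_sing_of_orthogonal hk hn
    (sub_mem (single_add_opF_mem_sing hk hn hI) (hrange _ hw)) fun s hs => ?_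
  rw [add_sub_right_comm, shap_add_left, horth _ hw s hs, shap_opF_of_mem_sing _ hs, add_zero]
end
end

section
/- For pairwise distinct $u_1,\dots,u_n \in \mathbb{C}$ and all $m, j \in \{1,\dots,n\}$, the Gaudin Hamiltonians commute: $H_m(u)\,H_j(u) = H_j(u)\,H_m(u)$ as operators on $W^{\otimes n}$. -/
noncomputable section

/-- Action of `e` in the `i`-th tensor factor. -/
def eAt {n : ℕ} (i : Fin n) : WT n →ₗ[ℂ] WT n :=
  mkOp fun I => if i ∈ I then Finsupp.single (I.erase i) 1 else 0

/-- Action of `f` in the `i`-th tensor factor. -/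
def fAt {n : ℕ} (i : Fin n) : WT n →ₗ[ℂ] WT n :=
  mkOp fun I => if i ∈ I then 0 else Finsupp.single (insert i I) 1

/-- Action of `h` in the `i`-th tensor factor. -/
def hAt {n : ℕ} (i : Fin n) : WT n →ₗ[ℂ] WT n :=
  mkOp fun I => (if i ∈ I then (-1 : ℂ) else 1) • Finsupp.single I 1

/-- The Casimir operator `Ω = ½ h⊗h + e⊗f + f⊗e` acting in the `m`-th and `j`-th
tensor factors of `W^{⊗n}`. -/
def Omega {n : ℕ} (m j : Fin n) : WT n →ₗ[ℂ] WT n :=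
  (2⁻¹ : ℂ) • (hAt m ∘ₗ hAt j) + eAt m ∘ₗ fAt j + fAt m ∘ₗ eAt j

/-- The reduced Casimir operator `Ω̄ = Ω - ½` acting in the `m`-th and `j`-th factors. -/
def OmegaBar {n : ℕ} (m j : Fin n) : WT n →ₗ[ℂ] WT n :=
  Omega m j - (2⁻¹ : ℂ) • LinearMap.id

/-- The Gaudin Hamiltonian `H_m(u) = ∑_{j ≠ m} Ω_{mj} / (u_m - u_j)`. -/
def gaudin {n : ℕ} (u : Fin n → ℂ) (m : Fin n) : WT n →ₗ[ℂ] WT n :=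
  ∑ j ∈ Finset.univ.erase m, (u m - u j)⁻¹ • Omega m j

/-- The reduced Gaudin Hamiltonian `H̄_m(u) = ∑_{j ≠ m} Ω̄_{mj} / (u_m - u_j)`. -/
def gaudinBar {n : ℕ} (u : Fin n → ℂ) (m : Fin n) : WT n →ₗ[ℂ] WT n :=
  ∑ j ∈ Finset.univ.erase m, (u m - u j)⁻¹ • OmegaBar m j

section InfinitesimalBraid

attribute [local instance] LieRing.ofAssociativeRing

variable {ι K A : Type*} [Field K] [Ring A] [Algebra K A] {T : ι → ι → A} {u : ι → K}

/-- The contributions of an index `k` to the commutator of two Gaudin Hamiltonians cancel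
as soon as the infinitesimal braid relations hold. -/
theorem lie_gaudin_terms_eq_zero (hu : Function.Injective u) (hsymm : ∀ a b, T a b = T b a)
    (hbraid : ∀ a b c, a ≠ b → a ≠ c → b ≠ c → ⁅T a b, T a c + T b c⁆ = 0)
    {m j k : ι} (hmj : m ≠ j) (hmk : m ≠ k) (hjk : j ≠ k) :
    ((u m - u j)⁻¹ * (u j - u k)⁻¹) • ⁅T m j, T j k⁆ +
      ((u m - u k)⁻¹ * (u j - u m)⁻¹) • ⁅T m k, T m j⁆ +
      ((u m - u k)⁻¹ * (u j - u k)⁻¹) • ⁅T m k, T j k⁆ = 0 := by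
  have hX := hbraid m j k hmj hmk hjk
  have hY := hbraid m k j hmk hmj hjk.symm
  rw [lie_add, ← lie_skew, neg_add_eq_zero] at hX
  rw [lie_add, hsymm k j, add_comm, add_eq_zero_iff_eq_neg] at hY
  rw [← hX, hY, smul_neg, ← sub_eq_add_neg, ← add_smul, ← sub_smul]
  have h₁ : u m - u j ≠ 0 := sub_ne_zero.2 (hu.ne hmj)
  have h₂ : u m - u k ≠ 0 := sub_ne_zero.2 (hu.ne hmk)
  have h₃ : u j - u k ≠ 0 := sub_ne_zero.2 (hu.ne hjk)
  have hcoeff : (u m - u j)⁻¹ * (u j - u k)⁻¹ + (u m - u k)⁻¹ * (u j - u m)⁻¹ -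
      (u m - u k)⁻¹ * (u j - u k)⁻¹ = 0 := by
    rw [← neg_sub (u m) (u j), inv_neg]
    field_simp
    ring
  rw [hcoeff, zero_smul]

/-- The Gaudin Hamiltonians attached to a symmetric family `T` satisfying the infinitesimal
braid relations commute. -/
theorem lie_sum_erase_eq_zero_of_infinitesimal_braid [Fintype ι] [DecidableEq ι]
    (hu : Function.Injective u) (hsymm : ∀ a b, T a b = T b a)
    (hdisj : ∀ a b c d, a ≠ b → c ≠ d → a ≠ c → a ≠ d → b ≠ c → b ≠ d → ⁅T a b, T c d⁆ = 0)
    (hbraid : ∀ a b c, a ≠ b → a ≠ c → b ≠ c → ⁅T a b, T a c + T b c⁆ = 0)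
    {m j : ι} (hmj : m ≠ j) :
    ⁅∑ k ∈ Finset.univ.erase m, (u m - u k)⁻¹ • T m k,
      ∑ k ∈ Finset.univ.erase j, (u j - u k)⁻¹ • T j k⁆ = 0 := by
  rw [← Finset.add_sum_erase (Finset.univ.erase m) _ (a := j) (by simp [hmj.symm]),
    ← Finset.add_sum_erase (Finset.univ.erase j) _ (a := m) (by simp [hmj]),
    Finset.erase_right_comm (a := j), hsymm j m]
  set s := (Finset.univ.erase m).erase j with hs
  have hmem : ∀ k ∈ s, m ≠ k ∧ j ≠ k := fun k hk => by
    simp only [hs, Finset.mem_erase] at hk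
    exact ⟨hk.2.1.symm, hk.1.symm⟩
  have hdiag : ∀ k ∈ s, ∑ l ∈ s, ((u m - u k)⁻¹ * (u j - u l)⁻¹) • ⁅T m k, T j l⁆ =
      ((u m - u k)⁻¹ * (u j - u k)⁻¹) • ⁅T m k, T j k⁆ := by
    intro k hk
    refine Finset.sum_eq_single_of_mem k hk fun l hl hlk => ?_
    rw [hdisj _ _ _ _ (hmem k hk).1 (hmem l hl).2 hmj (hmem l hl).1
      (hmem k hk).2.symm hlk.symm, smul_zero]
  have hsmul : ∀ (a b : K) (x y : A), ⁅a • x, b • y⁆ = (a * b) • ⁅x, y⁆ := fun a b x y => by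
    simp only [Ring.lie_def, smul_mul_smul_comm, smul_sub, mul_comm b a]
  rw [lie_add, add_lie, add_lie, sum_lie_sum, lie_sum, sum_lie]
  simp only [hsmul, lie_self, smul_zero, zero_add]
  rw [Finset.sum_congr rfl hdiag, ← add_assoc, add_comm (∑ k ∈ s, _), ← Finset.sum_add_distrib,
    ← Finset.sum_add_distrib]
  exact Finset.sum_eq_zero fun k hk =>
    lie_gaudin_terms_eq_zero hu hsymm hbraid hmj (hmem k hk).1 (hmem k hk).2

/-- Shifted flips `ρ(ab) - q` in a representation `ρ` of the symmetric group have the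
commutators of the flips. -/
theorem lie_shifted_swap [DecidableEq ι] (ρ : Equiv.Perm ι →* A) {q : K}
    (hT : ∀ a b, a ≠ b → T a b + q • 1 = ρ (Equiv.swap a b))
    {a b c d : ι} (hab : a ≠ b) (hcd : c ≠ d) :
    ⁅T a b, T c d⁆ =
      ρ (Equiv.swap a b * Equiv.swap c d) - ρ (Equiv.swap c d * Equiv.swap a b) := by
  rw [map_mul, map_mul, ← hT a b hab, ← hT c d hcd, Ring.lie_def]
  simp only [add_mul, mul_add, smul_add, smul_mul_assoc, mul_smul_comm, one_mul,
    mul_one]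
  abel

/-- The Gaudin Hamiltonians attached to shifted flips in a representation of the symmetric
group commute. -/
theorem commute_sum_erase_of_shifted_swap [Fintype ι] [DecidableEq ι]
    (hu : Function.Injective u) (ρ : Equiv.Perm ι →* A) {q : K}
    (hT : ∀ a b, a ≠ b → T a b + q • 1 = ρ (Equiv.swap a b)) (m j : ι) :
    Commute (∑ k ∈ Finset.univ.erase m, (u m - u k)⁻¹ • T m k)
      (∑ k ∈ Finset.univ.erase j, (u j - u k)⁻¹ • T j k) := by
  rcases eq_or_ne m j with rfl | hmj
  · exact Commute.refl _
  rw [commute_iff_lie_eq]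
  refine lie_sum_erase_eq_zero_of_infinitesimal_braid hu ?_ ?_ ?_ hmj
  · intro a b
    rcases eq_or_ne a b with rfl | hab
    · rfl
    · exact add_right_cancel (b := q • (1 : A))
        (by rw [hT a b hab, hT b a hab.symm, Equiv.swap_comm])
  · intro a b c d hab hcd hac had hbc hbd
    have hdisj : (Equiv.swap a b).Disjoint (Equiv.swap c d) := by
      intro x
      simp only [Equiv.swap_apply_def]
      grind
    rw [lie_shifted_swap ρ hT hab hcd, hdisj.commute.eq, sub_self]
  · intro a b c hab hac hbc
    have hswap : Equiv.swap a b * Equiv.swap a c = Equiv.swap b c * Equiv.swap a b := by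
      ext x
      simp only [Equiv.Perm.mul_apply, Equiv.swap_apply_def]
      grind
    have hswap' : Equiv.swap a b * Equiv.swap b c = Equiv.swap a c * Equiv.swap a b := by
      ext x
      simp only [Equiv.Perm.mul_apply, Equiv.swap_apply_def]
      grind
    rw [lie_add, lie_shifted_swap ρ hT hab hac, lie_shifted_swap ρ hT hab hbc, hswap, hswap']
    abel

end InfinitesimalBraid

/-- An operator built by `mkOp` takes the prescribed values on basis vectors. -/
theorem mkOp_single {n : ℕ} (φ : Finset (Fin n) → WT n) (I : Finset (Fin n)) :
    mkOp φ (Finsupp.single I 1) = φ I := by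
  simp [mkOp]

/-- The representation of the symmetric group on `W^{⊗n}` permuting the tensor factors. -/
def permRep (n : ℕ) : Equiv.Perm (Fin n) →* Module.End ℂ (WT n) where
  toFun σ := mkOp fun I => Finsupp.single (I.map σ.toEmbedding) 1
  map_one' := by
    refine Finsupp.lhom_ext' fun I => LinearMap.ext_ring ?_
    simp only [LinearMap.comp_apply, Finsupp.lsingle_apply, mkOp_single, Module.End.one_apply]
    exact congrArg (Finsupp.single · 1) Finset.map_refl
  map_mul' σ τ := by
    refine Finsupp.lhom_ext' fun I => LinearMap.ext_ring ?_
    simp only [LinearMap.comp_apply, Module.End.mul_apply, Finsupp.lsingle_apply,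
      mkOp_single, Finset.map_map]
    rfl

theorem permRep_single {n : ℕ} (σ : Equiv.Perm (Fin n)) (I : Finset (Fin n)) :
    permRep n σ (Finsupp.single I 1) = Finsupp.single (I.map σ.toEmbedding) 1 :=
  mkOp_single _ I

/-- The Casimir operator in two distinct factors is the flip of these factors minus `½`. -/
theorem Omega_add_half_eq_permRep_swap {n : ℕ} {m j : Fin n} (hmj : m ≠ j) :
    Omega m j + (2⁻¹ : ℂ) • 1 = permRep n (Equiv.swap m j) := by
  refine Finsupp.lhom_ext' fun I => LinearMap.ext_ring ?_
  have mem_map_swap (a : Fin n) :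
      a ∈ I.map (Equiv.swap m j).toEmbedding ↔ Equiv.swap m j a ∈ I := by
    rw [Finset.mem_map_equiv, Equiv.symm_swap]
  simp only [Omega, eAt, fAt, hAt, LinearMap.comp_apply, LinearMap.add_apply,
    LinearMap.smul_apply, Module.End.one_apply, Finsupp.lsingle_apply, mkOp_single,
    permRep_single, map_smul]
  by_cases hm : m ∈ I <;> by_cases hj : j ∈ I
  · have hI : I.map (Equiv.swap m j).toEmbedding = I := by
      ext a; rw [mem_map_swap, Equiv.swap_apply_def]; grind
    simp only [hm, hj, hI, if_true, map_zero, mkOp_single, Finset.mem_erase, hmj, ne_eq,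
      not_false_eq_true, and_self]
    module
  · have hI : I.map (Equiv.swap m j).toEmbedding = (insert j I).erase m := by
      ext a; rw [mem_map_swap, Equiv.swap_apply_def]; grind
    simp only [hm, hj, hI, if_true, if_false, map_zero, mkOp_single, Finset.mem_insert, or_true]
    module
  · have hI : I.map (Equiv.swap m j).toEmbedding = insert m (I.erase j) := by
      ext a; rw [mem_map_swap, Equiv.swap_apply_def]; grind
    simp only [hm, hj, hI, if_true, if_false, map_zero, mkOp_single, Finset.mem_erase, and_false]
    module
  · have hI : I.map (Equiv.swap m j).toEmbedding = I := by
      ext a; rw [mem_map_swap, Equiv.swap_apply_def]; grind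
    simp only [hm, hj, hI, if_false, map_zero, mkOp_single, Finset.mem_insert, hmj, or_self]
    module

/-- the Gaudin Hamiltonians commute:
`H_m(u) H_j(u) = H_j(u) H_m(u)` for pairwise distinct `u₁, …, u_n`. -/
theorem stmt8 (n : ℕ) (hn : 1 ≤ n) (u : Fin n → ℂ) (hu : Function.Injective u)
    (m j : Fin n) :
    gaudin u m ∘ₗ gaudin u j = gaudin u j ∘ₗ gaudin u m := by
  exact (commute_sum_erase_of_shifted_swap (A := Module.End ℂ (WT n)) hu (permRep n)
    (fun _ _ => Omega_add_half_eq_permRep_swap) m j).eq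
end
end
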